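/- arXiv:2603.23055 — 4 statements merged into one kernel-verified Lean document; each statement's English description precedes it below -/
import Mathlib

section
/- Necessary condition for PS-DME with a power e-calibrator to beat SS-DME: Fix δ ∈ (0,1), integers 1 ≤ |𝒦| ≤ K with δ|𝒦|/K < 1, positive integers n_k^eval ≤ n_k, and let w be the unique real number w ≤ −1 satisfying w e^w = −δ|𝒦|/(eK) (the value of the lower real branch of the Lambert W function at −δ|𝒦|/(eK)). If there exists τ ∈ (0,1) such that the PS-DME band width sqrt((1/(2 n_k)) · log(2 / f_τ^{-1}(K/(δ|𝒦|)))) is strictly smaller than the SS-DME band width sqrt((1/(2 n_k^eval)) · log(2K/(δ|𝒦|))), then necessarily n_k^eval / n_k < log(2K/(δ|𝒦|)) / (log 2 − w). -/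
open MeasureTheory

/-- The power-family e-calibrator `f_τ(p) = (1−τ) p^{−τ}` for `p ∈ (0,1]`
(extended by `∞` at `p ≤ 0`). -/
noncomputable def powCal (τ : ℝ) : ℝ → ENNReal := fun p =>
  if p ≤ 0 then ⊤ else ENNReal.ofReal ((1 - τ) * p ^ (-τ))

/-- Generalized inverse of an e-calibrator: `f⁻¹(t) = sup {u ∈ [0,1] : f(u) ≥ t}`. -/
noncomputable def ecalInv (f : ℝ → ENNReal) (t : ENNReal) : ℝ :=
  sSup {u | u ∈ Set.Icc (0:ℝ) 1 ∧ t ≤ f u}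

/-- Above its value at `1`, the power calibrator is inverted by `t ↦ ((1 - τ) / t) ^ τ⁻¹`. -/
theorem ecalInv_powCal {τ t : ℝ} (hτ : τ ∈ Set.Ioo (0 : ℝ) 1) (ht : 1 - τ ≤ t) :
    ecalInv (powCal τ) (ENNReal.ofReal t) = ((1 - τ) / t) ^ τ⁻¹ := by
  obtain ⟨hτ0, hτ1⟩ := hτ
  have h1τ : 0 < 1 - τ := by linarith
  have ht0 : 0 < t := h1τ.trans_le ht
  have hr0 : 0 < (1 - τ) / t := div_pos h1τ ht0
  have hv0 : 0 < ((1 - τ) / t) ^ τ⁻¹ := Real.rpow_pos_of_pos hr0 _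
  have hv1 : ((1 - τ) / t) ^ τ⁻¹ ≤ 1 :=
    Real.rpow_le_one hr0.le ((div_le_one ht0).2 ht) (inv_pos.2 hτ0).le
  have key : ∀ u, 0 < u →
      (ENNReal.ofReal t ≤ powCal τ u ↔ u ≤ ((1 - τ) / t) ^ τ⁻¹) := by
    intro u hu
    have hpow : 0 < u ^ τ := Real.rpow_pos_of_pos hu _
    rw [powCal, if_neg hu.not_ge, ENNReal.ofReal_le_ofReal_iff (by positivity),
      Real.le_rpow_inv_iff_of_pos hu.le hr0.le hτ0, Real.rpow_neg hu.le, ← div_eq_mul_inv,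
      le_div_iff₀ hpow, le_div_iff₀ ht0, mul_comm]
  refine IsGreatest.csSup_eq ⟨⟨⟨hv0.le, hv1⟩, (key _ hv0).2 le_rfl⟩, ?_⟩
  rintro u ⟨⟨hu0, -⟩, hu⟩
  rcases hu0.eq_or_lt with rfl | hu0
  · exact hv0.le
  · exact (key u hu0).1 hu

/-- The negative logarithm of `((1 - τ) / t) ^ τ⁻¹` is at least `-w` for every solution `w < 0` of
`w e ^ w = -1 / (e t)`, that is, for each real Lambert W branch. -/
theorem neg_lambert_le {τ t w : ℝ} (hτ : τ ∈ Set.Ioo (0 : ℝ) 1) (ht : 0 < t) (hw : w < 0)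
    (hwt : w * Real.exp w = -(1 / (Real.exp 1 * t))) :
    -w ≤ τ⁻¹ * (Real.log t - Real.log (1 - τ)) := by
  obtain ⟨hτ0, hτ1⟩ := hτ
  have h1τ : 0 < 1 - τ := by linarith
  have hlog : Real.log (-w) + w = -(1 + Real.log t) := by
    have h := congrArg Real.log (show -w * Real.exp w = (Real.exp 1 * t)⁻¹ by
      rw [neg_mul, hwt, neg_neg, one_div])
    rwa [Real.log_mul (by linarith) (Real.exp_ne_zero _), Real.log_exp, Real.log_inv,
      Real.log_mul (Real.exp_ne_zero _) ht.ne', Real.log_exp] at h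
  have hle := Real.log_le_sub_one_of_pos (mul_pos (neg_pos.2 hw) h1τ)
  rw [Real.log_mul (by linarith) h1τ.ne'] at hle
  rw [inv_mul_eq_div, le_div_iff₀ hτ0]
  linarith

/-- **Necessary condition for PS-DME with a power e-calibrator to beat SS-DME.**
Let `δ ∈ (0,1)`, `1 ≤ |𝒦| ≤ K` with `δ|𝒦|/K < 1`, positive sample sizes
`n_k^eval ≤ n_k`, and let `w ≤ −1` satisfy `w e^w = −δ|𝒦|/(eK)` (the lower Lambert-W
branch at `−δ|𝒦|/(eK)`).  If for some `τ ∈ (0,1)` the PS-DME band width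
`sqrt((1/(2 n_k)) log(2 / f_τ⁻¹(K/(δ|𝒦|))))` is strictly smaller than the SS-DME band
width `sqrt((1/(2 n_k^eval)) log(2K/(δ|𝒦|)))`, then necessarily
`n_k^eval / n_k < log(2K/(δ|𝒦|)) / (log 2 − w)`. -/
theorem psdme_power_calibrator_necessary_condition
    (δ : ℝ) (hδ : δ ∈ Set.Ioo (0:ℝ) 1)
    (K M : ℕ) (hM : 1 ≤ M) (hMK : M ≤ K)
    (hratio : δ * (M : ℝ) / (K : ℝ) < 1)
    (nk nkeval : ℕ) (hnkeval : 0 < nkeval) (hle : nkeval ≤ nk)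
    (w : ℝ) (hw : w ≤ -1)
    (hwe : w * Real.exp w = -(δ * (M : ℝ)) / (Real.exp 1 * (K : ℝ)))
    (hexists : ∃ τ ∈ Set.Ioo (0:ℝ) 1,
      Real.sqrt ((1 / (2 * (nk : ℝ))) *
          Real.log (2 / ecalInv (powCal τ) (ENNReal.ofReal ((K : ℝ) / (δ * (M : ℝ))))))
        < Real.sqrt ((1 / (2 * (nkeval : ℝ))) *
            Real.log ((2 * (K : ℝ)) / (δ * (M : ℝ))))) :
    (nkeval : ℝ) / (nk : ℝ)
      < Real.log ((2 * (K : ℝ)) / (δ * (M : ℝ))) / (Real.log 2 - w) := by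
  obtain ⟨τ, hτ, hlt⟩ := hexists
  have hM0 : (0 : ℝ) < M := by exact_mod_cast hM
  have hK0 : (0 : ℝ) < K := by exact_mod_cast hM.trans hMK
  have hδM : 0 < δ * (M : ℝ) := mul_pos hδ.1 hM0
  have hne : (0 : ℝ) < nkeval := by exact_mod_cast hnkeval
  have hn : (0 : ℝ) < nk := by exact_mod_cast hnkeval.trans_le hle
  have h1τ : 0 < 1 - τ := by linarith [hτ.2]
  have ht1 : 1 < (K : ℝ) / (δ * M) := by
    rw [div_lt_one hK0] at hratio
    exact (one_lt_div hδM).2 hratio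
  have ht0 : 0 < (K : ℝ) / (δ * M) := one_pos.trans ht1
  have hbound := neg_lambert_le hτ ht0 (by linarith) (hwe.trans (by field_simp))
  have hr0 := div_pos h1τ ht0
  have hwidth : Real.log 2 - w ≤
      Real.log (2 / ecalInv (powCal τ) (ENNReal.ofReal ((K : ℝ) / (δ * M)))) := by
    rw [ecalInv_powCal hτ (by linarith [hτ.1]),
      Real.log_div two_ne_zero (Real.rpow_pos_of_pos hr0 _).ne', Real.log_rpow hr0,
      Real.log_div h1τ.ne' ht0.ne']
    linarith
  have hpos : 0 < Real.log 2 - w := by linarith [Real.log_pos one_lt_two]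
  have hlt' := lt_of_not_ge fun h => hlt.not_ge (Real.sqrt_le_sqrt h)
  have hscaled := (mul_le_mul_of_nonneg_left hwidth
    (by positivity : 0 ≤ 1 / (2 * (nk : ℝ)))).trans_lt hlt'
  rw [one_div_mul_eq_div, one_div_mul_eq_div, div_lt_div_iff₀ (by positivity) (by positivity)]
    at hscaled
  rw [div_lt_div_iff₀ hn hpos]
  linarith
end

section
/- Calibration of p-values into e-values: Let U be a [0,1]-valued random variable that is super-uniform, i.e., P(U ≤ α) ≤ α for every α ∈ [0,1], and let f be an e-calibrator. Then E[f(U)] ≤ 1; that is, f(U) is a valid e-value. -/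
open MeasureTheory

/-- An e-calibrator: a nonincreasing, upper semicontinuous function
`f : [0,1] → [0,∞]` with `∫_0^1 f(u) du ≤ 1`. -/
def IsECalibrator (f : ℝ → ENNReal) : Prop :=
  AntitoneOn f (Set.Icc 0 1) ∧
  UpperSemicontinuousOn f (Set.Icc 0 1) ∧
  ∫⁻ u in Set.Icc (0:ℝ) 1, f u ≤ 1

theorem ENNReal.min_natCast_ne_top (x : ENNReal) (n : ℕ) : min x n ≠ ⊤ :=
  ((min_le_right _ _).trans_lt (ENNReal.natCast_lt_top n)).ne

/-- The layer-cake formula for a truncated `ENNReal`-valued function. -/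
theorem lintegral_min_natCast_eq_lintegral_measure_lt {α : Type*} [MeasurableSpace α]
    {μ : Measure α} {f : α → ENNReal} (hf : Measurable f) (n : ℕ) :
    ∫⁻ a, min (f a) n ∂μ = ∫⁻ t in Set.Ioi (0 : ℝ), μ {a | t < (min (f a) n).toReal} := by
  rw [← lintegral_eq_lintegral_meas_lt μ (.of_forall fun _ => ENNReal.toReal_nonneg)
    (hf.min measurable_const).ennreal_toReal.aemeasurable]
  simp only [ENNReal.ofReal_toReal (ENNReal.min_natCast_ne_top _ n)]

/-- Layer-cake comparison: if every strict superlevel set of `f` has `μ`-measure at most the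
`ν`-measure of the corresponding superlevel set of `g`, then `∫⁻ f ∂μ ≤ ∫⁻ g ∂ν`. -/
theorem lintegral_le_lintegral_of_measure_lt_le {α β : Type*} [MeasurableSpace α]
    [MeasurableSpace β] {μ : Measure α} {ν : Measure β} {f : α → ENNReal} {g : β → ENNReal}
    (hf : Measurable f) (hg : Measurable g)
    (h : ∀ t : ENNReal, μ {a | t < f a} ≤ ν {b | t < g b}) :
    ∫⁻ a, f a ∂μ ≤ ∫⁻ b, g b ∂ν := by
  have hsup (x : ENNReal) : ⨆ n : ℕ, min x n = x := by
    rw [← inf_iSup_eq, ENNReal.iSup_natCast, inf_top_eq]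
  have hmono : Monotone fun (n : ℕ) (a : α) => min (f a) n := fun m n hmn a =>
    min_le_min_left _ (Nat.cast_le.2 hmn)
  have hlim : ∫⁻ a, f a ∂μ = ⨆ n : ℕ, ∫⁻ a, min (f a) n ∂μ := by
    rw [← lintegral_iSup (fun n => hf.min measurable_const) hmono]
    simp only [hsup]
  rw [hlim]
  refine iSup_le fun n => le_trans ?_ (lintegral_mono fun b => min_le_left (g b) (n : ENNReal))
  rw [lintegral_min_natCast_eq_lintegral_measure_lt hf,
    lintegral_min_natCast_eq_lintegral_measure_lt hg]
  refine setLIntegral_mono' measurableSet_Ioi fun t ht => ?_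
  simp only [← ENNReal.ofReal_lt_iff_lt_toReal (le_of_lt ht) (ENNReal.min_natCast_ne_top _ n),
    lt_min_iff]
  by_cases htn : ENNReal.ofReal t < n
  · simpa only [htn, and_true] using h (ENNReal.ofReal t)
  · simp [htn]

/-- A super-uniform random variable charges a lower subset of `[0,1]` at most as much as
Lebesgue measure does. -/
theorem measure_preimage_le_volume_of_superuniform {Ω : Type*} [MeasurableSpace Ω]
    {μ : Measure Ω} {U : Ω → ℝ} (hrange : ∀ ω, U ω ∈ Set.Icc (0 : ℝ) 1)
    (hsuper : ∀ α ∈ Set.Icc (0 : ℝ) 1, μ {ω | U ω ≤ α} ≤ ENNReal.ofReal α)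
    {s : Set ℝ} (hs : IsLowerSet s) :
    μ {ω | U ω ∈ s} ≤ volume (s ∩ Set.Icc 0 1) := by
  rcases (s ∩ Set.Icc 0 1).eq_empty_or_nonempty with h | hne
  · have : {ω | U ω ∈ s} = ∅ :=
      Set.eq_empty_of_forall_notMem fun ω hω => (h ▸ ⟨hω, hrange ω⟩ : U ω ∈ (∅ : Set ℝ))
    simp [this]
  have hbdd : BddAbove (s ∩ Set.Icc 0 1) := bddAbove_Icc.mono Set.inter_subset_right
  have hmem : sSup (s ∩ Set.Icc 0 1) ∈ Set.Icc (0 : ℝ) 1 :=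
    ⟨Real.sSup_nonneg fun x hx => hx.2.1, csSup_le hne fun x hx => hx.2.2⟩
  calc μ {ω | U ω ∈ s} ≤ μ {ω | U ω ≤ sSup (s ∩ Set.Icc 0 1)} :=
        measure_mono fun ω hω => le_csSup hbdd ⟨hω, hrange ω⟩
    _ ≤ ENNReal.ofReal (sSup (s ∩ Set.Icc 0 1)) := hsuper _ hmem
    _ = volume (Set.Ico 0 (sSup (s ∩ Set.Icc 0 1))) := by simp
    _ ≤ volume (s ∩ Set.Icc 0 1) := measure_mono fun x hx => by
        obtain ⟨y, hy, hxy⟩ := exists_lt_of_lt_csSup hne hx.2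
        exact ⟨hs hxy.le hy.1, hx.1, hxy.le.trans hy.2.2⟩

/-- **Calibration of p-values into e-values.**  If `U` is a `[0,1]`-valued random
variable that is super-uniform, i.e. `P(U ≤ α) ≤ α` for every `α ∈ [0,1]`, and `f` is an
e-calibrator, then `E[f(U)] ≤ 1`; that is, `f(U)` is a valid e-value. -/
theorem ecalibrator_gives_evalue
    {Ω : Type*} [MeasurableSpace Ω] (μ : Measure Ω) [IsProbabilityMeasure μ]
    (U : Ω → ℝ) (hU : Measurable U)
    (hrange : ∀ ω, U ω ∈ Set.Icc (0:ℝ) 1)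
    (hsuper : ∀ α ∈ Set.Icc (0:ℝ) 1, μ {ω | U ω ≤ α} ≤ ENNReal.ofReal α)
    (f : ℝ → ENNReal) (hf : IsECalibrator f) :
    ∫⁻ ω, f (U ω) ∂μ ≤ 1 := by
  obtain ⟨hanti, -, hint⟩ := hf
  set g : ℝ → ENNReal := Set.IccExtend zero_le_one ((Set.Icc (0 : ℝ) 1).domRestrict f)
  have hgf : Set.EqOn g f (Set.Icc 0 1) := fun x hx => Set.IccExtend_of_mem _ _ hx
  have hg_anti : Antitone g := fun x y hxy =>
    hanti (Subtype.prop _) (Subtype.prop _) (Set.monotone_projIcc zero_le_one hxy)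
  simp only [← hgf (hrange _)]
  rw [← setLIntegral_congr_fun measurableSet_Icc hgf] at hint
  refine le_trans (lintegral_le_lintegral_of_measure_lt_le (hg_anti.measurable.comp hU)
    hg_anti.measurable fun t => ?_) hint
  rw [Measure.restrict_apply (measurableSet_lt measurable_const hg_anti.measurable)]
  exact measure_preimage_le_volume_of_superuniform hrange hsuper
    fun x y hyx hx => lt_of_lt_of_le hx (hg_anti hyx)
end

section
/- Inverse of the Vovk–Sellke bound via the Lambert W lower branch: Fix y > 1 and let w be the unique real number w ≤ −1 satisfying w e^w = −1/(e y). Then the point p* = e^w lies in (0, e^{−1}), satisfies −e^{−1}/(p* · log p*) = y, and sup{p ∈ (0, e^{−1}]: −e^{−1}/(p · log p) ≥ y} = p*. In particular, the generalized inverse of the Vovk–Sellke bound satisfies f_VS^{-1}(y) = e^w. -/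
/-- The Vovk–Sellke bound: `f_VS(p) = −e⁻¹/(p log p)` for `p ∈ (0, e⁻¹]` and
`f_VS(p) = 1` for `p ∈ (e⁻¹, 1]`. -/
noncomputable def fVS (p : ℝ) : ℝ :=
  if p ≤ Real.exp (-1) then -(Real.exp (-1)) / (p * Real.log p) else 1

/-- The function `x ↦ x * exp x` is strictly decreasing on `(-∞, -1]`. -/
theorem strictAntiOn_mul_exp : StrictAntiOn (fun x : ℝ => x * Real.exp x) (Set.Iic (-1)) := by
  intro w _ v hv hwv
  have hv' : v ≤ -1 := hv
  have h1 : v - w + 1 < Real.exp (v - w) := Real.add_one_lt_exp (sub_pos.2 hwv).ne'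
  have h2 : v * Real.exp (v - w) < w := by nlinarith
  have h3 : Real.exp v = Real.exp (v - w) * Real.exp w := by rw [← Real.exp_add]; ring_nf
  change v * Real.exp v < w * Real.exp w
  rw [h3, ← mul_assoc]
  exact mul_lt_mul_of_pos_right h2 (Real.exp_pos w)

/-- **Inverse of the Vovk–Sellke bound via the Lambert-W lower branch.**
Fix `y > 1` and let `w ≤ −1` be the unique real number with `w e^w = −1/(e y)`.
Then `p* = e^w` lies in `(0, e⁻¹)`, satisfies `−e⁻¹/(p* log p*) = y`, and
`sup {p ∈ (0, e⁻¹] : −e⁻¹/(p log p) ≥ y} = p*`.  In particular, the generalized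
inverse of the Vovk–Sellke bound satisfies `f_VS⁻¹(y) = e^w`. -/
theorem vovk_sellke_inverse
    (y : ℝ) (hy : 1 < y)
    (w : ℝ) (hw : w ≤ -1)
    (hwe : w * Real.exp w = -1 / (Real.exp 1 * y)) :
    Real.exp w ∈ Set.Ioo (0:ℝ) (Real.exp (-1)) ∧
    -(Real.exp (-1)) / (Real.exp w * Real.log (Real.exp w)) = y ∧
    sSup {p | p ∈ Set.Ioc (0:ℝ) (Real.exp (-1)) ∧
        y ≤ -(Real.exp (-1)) / (p * Real.log p)} = Real.exp w ∧
    sSup {p | p ∈ Set.Ioc (0:ℝ) 1 ∧ y ≤ fVS p} = Real.exp w := by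
  have hy0 : 0 < y := by linarith
  have hwe' : y * (w * Real.exp w) = -Real.exp (-1) := by
    rw [hwe, Real.exp_neg]
    field_simp
  have hw' : w < -1 := by
    refine lt_of_le_of_ne hw fun h => ?_
    subst h
    nlinarith [Real.exp_pos (-1)]
  have hlt : Real.exp w < Real.exp (-1) := Real.exp_lt_exp.2 hw'
  have hval : -(Real.exp (-1)) / (Real.exp w * Real.log (Real.exp w)) = y := by
    have hne : Real.exp w * w ≠ 0 := mul_ne_zero (Real.exp_pos w).ne' (by linarith)
    rw [Real.log_exp, div_eq_iff hne, ← hwe', mul_comm w]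
  have hbound : ∀ p ∈ Set.Ioc (0:ℝ) (Real.exp (-1)),
      y ≤ -(Real.exp (-1)) / (p * Real.log p) → p ≤ Real.exp w := by
    rintro p ⟨hp0, hp1⟩ hp
    by_contra! hwp
    have hwlog : w < Real.log p := (Real.lt_log_iff_exp_lt hp0).2 hwp
    have hlog : Real.log p ≤ -1 := (Real.log_le_iff_le_exp hp0).2 hp1
    have hanti : Real.log p * Real.exp (Real.log p) < w * Real.exp w :=
      strictAntiOn_mul_exp hw hlog hwlog
    rw [Real.exp_log hp0, mul_comm] at hanti
    have hneg : p * Real.log p < 0 := mul_neg_of_pos_of_neg hp0 (by linarith)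
    rw [le_div_iff_of_neg hneg, ← hwe'] at hp
    exact absurd hp (not_le.2 (mul_lt_mul_of_pos_left hanti hy0))
  refine ⟨⟨Real.exp_pos w, hlt⟩, hval, ?_, ?_⟩
  · refine IsGreatest.csSup_eq ⟨⟨⟨Real.exp_pos w, hlt.le⟩, hval.ge⟩, ?_⟩
    rintro p ⟨hp, hyp⟩
    exact hbound p hp hyp
  · refine IsGreatest.csSup_eq ⟨⟨⟨Real.exp_pos w, Real.exp_le_one_iff.2 (by linarith)⟩, ?_⟩, ?_⟩
    · rw [fVS, if_pos hlt.le]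
      exact hval.ge
    · rintro p ⟨⟨hp0, _⟩, hyp⟩
      unfold fVS at hyp
      split_ifs at hyp with h
      · exact hbound p ⟨hp0, h⟩ hyp
      · linarith
end

section
/- Abstract e-value false coverage rate bound under arbitrary selection: Let E_1,…,E_K be nonnegative random variables on a common probability space with E[E_k] ≤ 1 for every k ∈ {1,…,K}, let 𝒦 be any random subset of {1,…,K} (measurable and arbitrarily dependent on E_1,…,E_K), and let δ ∈ (0,1). Then E[ (1/max{|𝒦|,1}) · Σ_{k∈𝒦} 1{E_k ≥ K/(δ|𝒦|)} ] ≤ δ. -/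
open MeasureTheory
open scoped Classical

/-- For any selected set `S`, the proportion of indices of `S` whose value crosses the
selection-adjusted threshold is at most `δ / K` times the sum of all the values. -/
lemma crossing_proportion_le {K : ℕ} (e : Fin K → ℝ) (he : ∀ k, 0 ≤ e k) (S : Finset (Fin K))
    {δ : ℝ} (hδ : 0 < δ) :
    (∑ k ∈ S, if (K : ℝ) / (δ * (S.card : ℝ)) ≤ e k then (1 : ℝ) else 0) / max (S.card : ℝ) 1 ≤
      δ / K * ∑ k, e k := by
  rcases S.eq_empty_or_nonempty with rfl | ⟨i, hi⟩
  · simpa using mul_nonneg (by positivity : 0 ≤ δ / K) (Finset.sum_nonneg fun k _ => he k)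
  have hK : (0 : ℝ) < K := Nat.cast_pos.2 i.pos
  have hcard : (1 : ℝ) ≤ S.card := by exact_mod_cast Finset.card_pos.2 ⟨i, hi⟩
  have hcard0 : (0 : ℝ) < S.card := one_pos.trans_le hcard
  rw [max_eq_left hcard, div_le_iff₀ hcard0, Finset.mul_sum, Finset.sum_mul]
  refine (Finset.sum_le_sum fun k _ => ?_).trans
    (Finset.sum_le_univ_sum_of_nonneg fun k => by have := he k; positivity)
  split_ifs with h
  · rw [div_le_iff₀ (by positivity)] at h
    calc (1 : ℝ) = K / K := (div_self hK.ne').symm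
      _ ≤ e k * (δ * S.card) / K := by gcongr
      _ = δ / K * e k * S.card := by ring
  · have := he k
    positivity

/-- **Abstract e-value false coverage rate bound under arbitrary selection.**
Let `E_1, …, E_K` be nonnegative random variables with `E[E_k] ≤ 1` for every `k`, let
`𝒦` be any (measurable, arbitrarily data-dependent) random subset of `{1, …, K}`, and let
`δ ∈ (0,1)`.  Then
`E[(1/max{|𝒦|,1}) Σ_{k ∈ 𝒦} 1{E_k ≥ K/(δ|𝒦|)}] ≤ δ`. -/
theorem evalue_fcr_bound
    {Ω : Type*} [MeasurableSpace Ω] (μ : Measure Ω) [IsProbabilityMeasure μ]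
    (K : ℕ) (hK : 0 < K)
    (E : Fin K → Ω → ℝ)
    (hEmeas : ∀ k, Measurable (E k))
    (hEnonneg : ∀ k ω, 0 ≤ E k ω)
    (hEmean : ∀ k, ∫⁻ ω, ENNReal.ofReal (E k ω) ∂μ ≤ 1)
    (sel : Ω → Finset (Fin K))
    (hsel : ∀ A : Finset (Fin K), MeasurableSet {ω | sel ω = A})
    (δ : ℝ) (hδ : δ ∈ Set.Ioo (0:ℝ) 1) :
    ∫ ω, (∑ k ∈ sel ω,
        if (K : ℝ) / (δ * ((sel ω).card : ℝ)) ≤ E k ω then (1:ℝ) else 0) /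
      max ((sel ω).card : ℝ) 1 ∂μ ≤ δ := by
  have hδ0 : 0 < δ := hδ.1
  have hK0 : (0 : ℝ) < K := Nat.cast_pos.2 hK
  have hEint : ∀ k, Integrable (E k) μ := fun k =>
    ⟨(hEmeas k).aestronglyMeasurable,
      (hasFiniteIntegral_iff_ofReal (ae_of_all _ (hEnonneg k))).2
        ((hEmean k).trans_lt ENNReal.one_lt_top)⟩
  have hE : ∀ k, ∫ ω, E k ω ∂μ ≤ 1 := fun k => by
    rw [integral_eq_lintegral_of_nonneg_ae (ae_of_all _ (hEnonneg k))
      (hEmeas k).aestronglyMeasurable]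
    exact ENNReal.toReal_le_of_le_ofReal zero_le_one (by simpa using hEmean k)
  calc _ ≤ ∫ ω, δ / K * ∑ k, E k ω ∂μ := by
        refine integral_mono_of_nonneg (ae_of_all _ fun ω => ?_)
          ((integrable_finsetSum _ fun k _ => hEint k).const_mul _)
          (ae_of_all _ fun ω => crossing_proportion_le _ (fun k => hEnonneg k ω) _ hδ0)
        exact div_nonneg (Finset.sum_nonneg fun k _ => by split_ifs <;> norm_num) (by positivity)
    _ = δ / K * ∑ k, ∫ ω, E k ω ∂μ := by
        rw [integral_const_mul, integral_finsetSum _ fun k _ => hEint k]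
    _ ≤ δ / K * ∑ _k : Fin K, (1 : ℝ) := by
        gcongr with k
        exact hE k
    _ = δ := by
        simp [hK0.ne']
end
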